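/- arXiv:1412.6994 — 7 statements merged into one kernel-verified Lean document; each statement's English description precedes it below -/
import Mathlib

section
/- Two 1-tight frames u_1, …, u_N and v_1, …, v_N of ℝ^d are congruent — i.e. there exists an orthogonal transformation U of ℝ^d with u_i = U v_i for all i = 1, …, N — if and only if their vanishing subspaces coincide: ker P_{u} = ker P_{v}, where P_u, P_v : ℝ^N → ℝ^d are the respective frame projections. -/
open scoped RealInnerProductSpace

/-- The frame projection of a family `v : Fin N → ℝ^d`: the linear map `ℝ^N → ℝ^d`
sending the `i`-th standard basis vector to `v i`. -/
noncomputable def frameProj {N d : ℕ} (v : Fin N → EuclideanSpace ℝ (Fin d)) :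
    EuclideanSpace ℝ (Fin N) →ₗ[ℝ] EuclideanSpace ℝ (Fin d) where
  toFun x := ∑ i, x i • v i
  map_add' x y := by
    simp [add_smul, Finset.sum_add_distrib]
  map_smul' c x := by
    simp [smul_smul, Finset.smul_sum]

@[simp]
theorem frameProj_single {N d : ℕ} (v : Fin N → EuclideanSpace ℝ (Fin d)) (i : Fin N) :
    frameProj v (EuclideanSpace.single i 1) = v i := by
  simp [frameProj, ite_smul]

/-- A frame projection composed with its adjoint is the frame operator. -/
theorem frameProj_adjoint_apply {N d : ℕ} (v : Fin N → EuclideanSpace ℝ (Fin d))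
    (x : EuclideanSpace ℝ (Fin d)) :
    frameProj v (LinearMap.adjoint (frameProj v) x) = ∑ i, ⟪x, v i⟫ • v i := by
  have coord (i : Fin N) : LinearMap.adjoint (frameProj v) x i = ⟪x, v i⟫ := by
    rw [← frameProj_single v i, ← LinearMap.adjoint_inner_left,
      EuclideanSpace.inner_single_right]
    simp
  change ∑ i, LinearMap.adjoint (frameProj v) x i • v i = _
  simp only [coord]

/-- If `B` is a coisometry and `ker B ≤ ker A`, then `A` factors through `B` as `(A B†) B`. -/
theorem LinearMap.apply_adjoint_apply_of_ker_le {E F G : Type*}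
    [NormedAddCommGroup E] [InnerProductSpace ℝ E] [FiniteDimensional ℝ E]
    [NormedAddCommGroup F] [InnerProductSpace ℝ F] [FiniteDimensional ℝ F]
    [AddCommGroup G] [Module ℝ G]
    {A : E →ₗ[ℝ] G} {B : E →ₗ[ℝ] F} (hB : ∀ y, B (LinearMap.adjoint B y) = y)
    (hker : LinearMap.ker B ≤ LinearMap.ker A) (x : E) :
    A (LinearMap.adjoint B (B x)) = A x := by
  have hx : LinearMap.adjoint B (B x) - x ∈ LinearMap.ker B := by simp [hB]
  simpa [sub_eq_zero] using hker hx

/-- Two `1`-tight frames of `ℝ^d` of the same size are congruent (differ by an orthogonal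
transformation) if and only if their vanishing subspaces coincide. -/
theorem oneTight_congruent_iff_vanishing_eq {N d : ℕ}
    (u v : Fin N → EuclideanSpace ℝ (Fin d))
    (hu_span : Submodule.span ℝ (Set.range u) = ⊤)
    (hu_tight : ∀ x : EuclideanSpace ℝ (Fin d), ∑ i, ⟪x, u i⟫ • u i = x)
    (hv_span : Submodule.span ℝ (Set.range v) = ⊤)
    (hv_tight : ∀ x : EuclideanSpace ℝ (Fin d), ∑ i, ⟪x, v i⟫ • v i = x) :
    (∃ U : EuclideanSpace ℝ (Fin d) ≃ₗᵢ[ℝ] EuclideanSpace ℝ (Fin d), ∀ i, u i = U (v i)) ↔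
      LinearMap.ker (frameProj u) = LinearMap.ker (frameProj v) := by
  have hu (x) : frameProj u (LinearMap.adjoint (frameProj u) x) = x := by
    rw [frameProj_adjoint_apply, hu_tight]
  have hv (x) : frameProj v (LinearMap.adjoint (frameProj v) x) = x := by
    rw [frameProj_adjoint_apply, hv_tight]
  constructor
  · rintro ⟨U, hU⟩
    ext x
    have hUx : frameProj u x = U (frameProj v x) := by
      simp [frameProj, hU]
    simp [hUx]
  · intro hker
    let T := frameProj u ∘ₗ LinearMap.adjoint (frameProj v)
    have hT : ∀ x y, ⟪T x, T y⟫ = ⟪x, y⟫ := fun x y => by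
      change ⟪frameProj u (LinearMap.adjoint (frameProj v) x),
        frameProj u (LinearMap.adjoint (frameProj v) y)⟫ = _
      rw [← LinearMap.adjoint_inner_right, ← LinearMap.adjoint_inner_right,
        LinearMap.adjoint_adjoint, LinearMap.apply_adjoint_apply_of_ker_le hu hker.le, hv]
    refine ⟨(T.isometryOfInner hT).toLinearIsometryEquiv rfl, fun i => ?_⟩
    have hi := LinearMap.apply_adjoint_apply_of_ker_le hv hker.ge (EuclideanSpace.single i 1)
    rw [frameProj_single, frameProj_single] at hi
    exact hi.symm
end

section
/- Let v_1, …, v_{d+1} be vectors in ℝ^d forming an α-tight frame for some α > 0 (i.e. ∑_{i=1}^{d+1} ⟨x, v_i⟩ v_i = α x for all x ∈ ℝ^d) and satisfying ∑_{i=1}^{d+1} v_i = 0. Then the points v_1, …, v_{d+1} are the vertices of an equilateral simplex: all the norms ‖v_i‖ are equal, and all the pairwise distances ‖v_i − v_j‖ for i ≠ j are equal to a common positive constant. -/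
open scoped RealInnerProductSpace

/-- A linear relation among `d + 1` vectors spanning a `d`-dimensional space and summing to zero
has all its coefficients equal. -/
theorem coeff_eq_of_span_eq_top_of_sum_eq_zero {K V ι : Type*} [Field K] [AddCommGroup V]
    [Module K V] [Fintype ι] [Nonempty ι] (v : ι → V)
    (hspan : Submodule.span K (Set.range v) = ⊤)
    (hcard : Fintype.card ι = Module.finrank K V + 1)
    (hsum : ∑ i, v i = 0) (c : ι → K) (hc : ∑ i, c i • v i = 0) (i j : ι) : c i = c j := by
  let L := Fintype.linearCombination K v
  have hker : Module.finrank K L.ker = 1 := by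
    have h := L.finrank_range_add_finrank_ker
    rw [Fintype.range_linearCombination, hspan, finrank_top, Module.finrank_fintype_fun_eq_card,
      hcard] at h
    omega
  have hone : (1 : ι → K) ∈ L.ker := by
    simp [L, Fintype.linearCombination_apply, hsum]
  have hc' : c ∈ L.ker := by
    simpa [L, Fintype.linearCombination_apply] using hc
  have hne : (⟨1, hone⟩ : L.ker) ≠ 0 := by
    simp [Subtype.ext_iff]
  obtain ⟨t, ht⟩ := (finrank_eq_one_iff_of_nonzero' _ hne).1 hker ⟨c, hc'⟩
  have ht' : t • (1 : ι → K) = c := congrArg Subtype.val ht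
  simp [← ht']

/-- If `d + 1` vectors of `ℝ^d` form an `α`-tight frame (`α > 0`) and sum to zero, then they
are the vertices of an equilateral simplex: they all have the same norm, and all pairwise
distances are equal to a common positive constant. -/
theorem tight_frame_sum_zero_is_equilateral_simplex {d : ℕ}
    (v : Fin (d + 1) → EuclideanSpace ℝ (Fin d))
    (hspan : Submodule.span ℝ (Set.range v) = ⊤)
    (α : ℝ) (hα : 0 < α)
    (htight : ∀ x : EuclideanSpace ℝ (Fin d), ∑ i, ⟪x, v i⟫ • v i = α • x)
    (hsum : ∑ i, v i = 0) :
    (∀ i j, ‖v i‖ = ‖v j‖) ∧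
      ∃ c : ℝ, 0 < c ∧ ∀ i j, i ≠ j → ‖v i - v j‖ = c := by
  have hcoeff (j i k : Fin (d + 1)) :
      ⟪v j, v i⟫ - (if i = j then α else 0) = ⟪v j, v k⟫ - (if k = j then α else 0) :=
    coeff_eq_of_span_eq_top_of_sum_eq_zero v hspan (by simp) hsum
      (fun i => ⟪v j, v i⟫ - (if i = j then α else 0))
      (by simp [sub_smul, Finset.sum_sub_distrib, htight, ite_smul]) i k
  have hinner (i j : Fin (d + 1)) (hij : i ≠ j) : ⟪v i, v i⟫ = ⟪v i, v j⟫ + α := by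
    have h := hcoeff i i j
    simp only [if_true, if_neg hij.symm] at h
    linarith
  have hself (i j : Fin (d + 1)) : ⟪v i, v i⟫ = ⟪v j, v j⟫ := by
    by_cases hij : i = j
    · rw [hij]
    · rw [hinner i j hij, hinner j i (Ne.symm hij), real_inner_comm]
  refine ⟨fun i j => ?_, √(2 * α), by positivity, fun i j hij => ?_⟩
  · rw [norm_eq_sqrt_real_inner, norm_eq_sqrt_real_inner, hself i j]
  · rw [norm_eq_sqrt_real_inner, real_inner_sub_sub_self]
    congr 1
    linarith [hself i j, hinner i j hij]
end

section
/- Let v_1, …, v_N be a frame of ℝ^d whose Gram matrix is essentially rational: there exists λ > 0 with ⟨v_i, v_j⟩ ∈ λℚ for all i, j = 1, …, N. Then the frame is crystallographic: the additive subgroup { k_1 v_1 + ⋯ + k_N v_N : k_1, …, k_N ∈ ℤ } is a discrete subgroup of ℝ^d (hence a lattice of ℝ^d, since it spans ℝ^d). -/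
open scoped RealInnerProductSpace

/-- If the pairwise inner products of the elements of `s` are integer multiples of `c`, then so are
those of the elements of the additive subgroup generated by `s`. -/
theorem exists_int_inner_eq_of_mem_closure {E : Type*} [NormedAddCommGroup E]
    [InnerProductSpace ℝ E] {s : Set E} {c : ℝ}
    (h : ∀ x ∈ s, ∀ y ∈ s, ∃ n : ℤ, ⟪x, y⟫ = c * n) {x y : E}
    (hx : x ∈ AddSubgroup.closure s) (hy : y ∈ AddSubgroup.closure s) :
    ∃ n : ℤ, ⟪x, y⟫ = c * n := by
  induction hx, hy using AddSubgroup.closure_induction₂ with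
  | mem x y hx hy => exact h x hx y hy
  | zero_left y hy => exact ⟨0, by simp⟩
  | zero_right x hx => exact ⟨0, by simp⟩
  | add_left x y z _ _ _ hx hy =>
    obtain ⟨m, hm⟩ := hx
    obtain ⟨n, hn⟩ := hy
    exact ⟨m + n, by rw [inner_add_left, hm, hn]; push_cast; ring⟩
  | add_right x y z _ _ _ hx hy =>
    obtain ⟨m, hm⟩ := hx
    obtain ⟨n, hn⟩ := hy
    exact ⟨m + n, by rw [inner_add_right, hm, hn]; push_cast; ring⟩
  | neg_left x y _ _ hx =>
    obtain ⟨m, hm⟩ := hx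
    exact ⟨-m, by rw [inner_neg_left, hm]; push_cast; ring⟩
  | neg_right x y _ _ hx =>
    obtain ⟨m, hm⟩ := hx
    exact ⟨-m, by rw [inner_neg_right, hm]; push_cast; ring⟩

/-- An additive subgroup in which all squared norms are integer multiples of some `c > 0` is
discrete. -/
theorem AddSubgroup.discreteTopology_of_inner_self_eq_mul_int {E : Type*} [NormedAddCommGroup E]
    [InnerProductSpace ℝ E] (L : AddSubgroup E) {c : ℝ} (hc : 0 < c)
    (h : ∀ x ∈ L, ∃ n : ℤ, ⟪x, x⟫ = c * n) : DiscreteTopology L := by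
  refine discreteTopology_of_isOpen_singleton_zero (Metric.isOpen_singleton_iff.2
    ⟨√c, Real.sqrt_pos.2 hc, fun x hx => ?_⟩)
  obtain ⟨n, hn⟩ := h x x.2
  have hx' : ‖(x : E)‖ < √c := by simpa using hx
  rw [Real.lt_sqrt (norm_nonneg _), ← real_inner_self_eq_norm_sq, hn] at hx'
  have hn1 : (n : ℝ) < 1 := by nlinarith
  have hn0 : (0 : ℝ) ≤ n := nonneg_of_mul_nonneg_right (hn ▸ real_inner_self_nonneg) hc
  have hn_zero : n = 0 := by
    have : n < 1 := by exact_mod_cast hn1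
    have : 0 ≤ n := by exact_mod_cast hn0
    lia
  rw [hn_zero, Int.cast_zero, mul_zero, inner_self_eq_zero] at hn
  exact Subtype.ext hn

/-- Finitely many rational numbers have a common denominator. -/
theorem Rat.exists_common_den {ι : Type*} [Finite ι] (q : ι → ℚ) :
    ∃ M : ℕ, 0 < M ∧ ∀ i, ∃ n : ℤ, q i = n / M := by
  have := Fintype.ofFinite ι
  refine ⟨∏ i, (q i).den, Finset.prod_pos fun i _ => (q i).pos, fun i => ?_⟩
  obtain ⟨k, hk⟩ := Finset.dvd_prod_of_mem (fun i => (q i).den) (Finset.mem_univ i)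
  have hM : (∏ i, (q i).den) ≠ 0 := Finset.prod_ne_zero_iff.2 fun i _ => (q i).den_nz
  refine ⟨(q i).num * k, ?_⟩
  rw [eq_div_iff (by exact_mod_cast hM), hk]
  push_cast
  rw [← mul_assoc, Rat.mul_den_eq_num]

/-- A frame of `ℝ^d` whose Gram matrix is essentially rational (all inner products lie in
`λ·ℚ` for some `λ > 0`) is crystallographic: the additive subgroup generated by the frame
vectors is a discrete subgroup of `ℝ^d` (hence a lattice, as it spans `ℝ^d`). -/
theorem crystallographic_of_essentially_rational_gram {N d : ℕ}
    (v : Fin N → EuclideanSpace ℝ (Fin d))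
    (hspan : Submodule.span ℝ (Set.range v) = ⊤)
    (lam : ℝ) (hlam : 0 < lam)
    (hrat : ∀ i j, ∃ q : ℚ, ⟪v i, v j⟫ = lam * q) :
    DiscreteTopology (AddSubgroup.closure (Set.range v)) := by
  choose q hq using hrat
  obtain ⟨M, hM, hqM⟩ := Rat.exists_common_den fun p : Fin N × Fin N => q p.1 p.2
  refine AddSubgroup.discreteTopology_of_inner_self_eq_mul_int _ (c := lam / M) (by positivity)
    fun x hx => exists_int_inner_eq_of_mem_closure ?_ hx hx
  rintro _ ⟨i, rfl⟩ _ ⟨j, rfl⟩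
  obtain ⟨n, hn⟩ := hqM (i, j)
  exact ⟨n, by rw [hq, show q i j = n / M from hn]; push_cast; ring⟩
end

section
/- Let H be a direct summand of ℤ^N of rank N − d (i.e. a subgroup such that ℤ^N/H is free abelian of rank d), with 0 < d ≤ N. Then there exists a crystallographic 1-tight frame v_1, …, v_N of ℝ^d whose vanishing subgroup equals H, i.e. { (k_1,…,k_N) ∈ ℤ^N : k_1 v_1 + ⋯ + k_N v_N = 0 } = H; moreover this frame is unique up to congruence: any two crystallographic 1-tight frames with vanishing subgroup H differ by an orthogonal transformation of ℝ^d applied to all vectors. -/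
open scoped RealInnerProductSpace

section Frames

variable {ι E : Type*} [Fintype ι] [NormedAddCommGroup E] [InnerProductSpace ℝ E]

/-- A `1`-tight system of vectors spans. -/
lemma span_range_eq_top_of_oneTight {v : ι → E} (hv : ∀ x, ∑ i, ⟪x, v i⟫ • v i = x) :
    Submodule.span ℝ (Set.range v) = ⊤ := by
  refine eq_top_iff.2 fun x _ => ?_
  rw [← hv x]
  exact Submodule.sum_mem _ fun i _ =>
    Submodule.smul_mem _ _ (Submodule.subset_span (Set.mem_range_self i))

/-- Every finite frame is mapped to a `1`-tight frame by some injective linear map. -/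
lemma exists_injective_oneTight_comp [FiniteDimensional ℝ E] {u : ι → E}
    (hu : Submodule.span ℝ (Set.range u) = ⊤) :
    ∃ A : E →ₗ[ℝ] E, Function.Injective A ∧ ∀ x, ∑ i, ⟪x, A (u i)⟫ • A (u i) = x := by
  let T : E →ₗ[ℝ] EuclideanSpace ℝ ι :=
    (WithLp.linearEquiv 2 ℝ (ι → ℝ)).symm.toLinearMap ∘ₗ
      LinearMap.pi fun i => (innerₗ E).flip (u i)
  have hT (x : E) (i : ι) : T x i = ⟪x, u i⟫ := rfl
  have hT_inj : Function.Injective T := by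
    refine (injective_iff_map_eq_zero T).2 fun x hx => ?_
    have hle : Submodule.span ℝ (Set.range u) ≤ LinearMap.ker (innerₗ E x) := by
      rw [Submodule.span_le]
      rintro _ ⟨i, rfl⟩
      simpa [hx] using (hT x i).symm
    have hmem := hle (hu ▸ Submodule.mem_top : x ∈ _)
    simpa using hmem
  let L := LinearEquiv.ofInjective T hT_inj
  let φ : E ≃ₗᵢ[ℝ] LinearMap.range T :=
    (stdOrthonormalBasis ℝ E).equiv (stdOrthonormalBasis ℝ _) (finCongr L.finrank_eq)
  let M : E →ₗ[ℝ] E := L.symm.toLinearMap ∘ₗ φ.toLinearEquiv.toLinearMap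
  have hM (x : E) (i : ι) : ⟪x, M.adjoint (u i)⟫ = (φ x : EuclideanSpace ℝ ι) i := by
    rw [LinearMap.adjoint_inner_right, ← hT]
    exact congrArg (fun y : LinearMap.range T => (y : EuclideanSpace ℝ ι) i)
      (L.apply_symm_apply (φ x))
  refine ⟨M.adjoint, (injective_iff_map_eq_zero _).2 fun x hx => ?_, fun x => ?_⟩
  · have h : ⟪M (φ.symm (L x)), x⟫ = 0 := by
      rw [← LinearMap.adjoint_inner_right, hx, inner_zero_right]
    simpa [M] using h
  · refine ext_inner_right ℝ fun y => ?_
    rw [sum_inner, ← φ.inner_map_map x y, Submodule.coe_inner, PiLp.inner_apply]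
    refine Finset.sum_congr rfl fun i _ => ?_
    rw [real_inner_smul_left, hM, real_inner_comm, hM]
    exact mul_comm _ _

/-- A linear map carrying a `1`-tight frame to a `1`-tight frame is orthogonal. -/
lemma exists_linearIsometryEquiv_of_oneTight [FiniteDimensional ℝ E] {v : ι → E} (B : E →ₗ[ℝ] E)
    (hv : ∀ x, ∑ i, ⟪x, v i⟫ • v i = x) (hBv : ∀ x, ∑ i, ⟪x, B (v i)⟫ • B (v i) = x) :
    ∃ U : E ≃ₗᵢ[ℝ] E, ∀ x, U x = B x := by
  have h : B * B.adjoint = 1 := by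
    ext x
    have := congrArg B (hv (B.adjoint x))
    simp only [map_sum, map_smul, LinearMap.adjoint_inner_left, hBv] at this
    exact this.symm
  have h' : B.adjoint * B = 1 := mul_eq_one_comm.1 h
  let U : E →ₗᵢ[ℝ] E := B.isometryOfInner fun x y => by
    rw [← LinearMap.adjoint_inner_right]
    exact congrArg (fun z => ⟪x, z⟫) (LinearMap.congr_fun h' y)
  exact ⟨U.toLinearIsometryEquiv rfl, fun x => rfl⟩

end Frames

lemma mkQ_eq_sum_smul_mkQ_single {R ι : Type*} [Ring R] [Fintype ι] [DecidableEq ι]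
    (H : Submodule R (ι → R)) (k : ι → R) :
    H.mkQ k = ∑ i, k i • H.mkQ (Pi.single i 1) := by
  conv_lhs => rw [pi_eq_sum_univ' k]
  simp only [map_sum, map_smul]

theorem exists_unique_crystallographic_oneTight_frame {N d : ℕ} (hd : 0 < d) (hdN : d ≤ N)
    (H : Submodule ℤ (Fin N → ℤ))
    (hfree : Module.Free ℤ ((Fin N → ℤ) ⧸ H))
    (hrank : Module.finrank ℤ ((Fin N → ℤ) ⧸ H) = d) :
    ∃ v : Fin N → EuclideanSpace ℝ (Fin d),
      Submodule.span ℝ (Set.range v) = ⊤ ∧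
      (∀ x : EuclideanSpace ℝ (Fin d), ∑ i, ⟪x, v i⟫ • v i = x) ∧
      DiscreteTopology (AddSubgroup.closure (Set.range v)) ∧
      (∀ k : Fin N → ℤ, (∑ i, (k i : ℝ) • v i = 0) ↔ k ∈ H) ∧
      (∀ w : Fin N → EuclideanSpace ℝ (Fin d),
        Submodule.span ℝ (Set.range w) = ⊤ →
        (∀ x : EuclideanSpace ℝ (Fin d), ∑ i, ⟪x, w i⟫ • w i = x) →
        DiscreteTopology (AddSubgroup.closure (Set.range w)) →
        (∀ k : Fin N → ℤ, (∑ i, (k i : ℝ) • w i = 0) ↔ k ∈ H) →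
        ∃ U : EuclideanSpace ℝ (Fin d) ≃ₗᵢ[ℝ] EuclideanSpace ℝ (Fin d),
          ∀ i, w i = U (v i)) := by
  let E := EuclideanSpace ℝ (Fin d)
  let c : Module.Basis (Fin d) ℤ ((Fin N → ℤ) ⧸ H) := Module.finBasisOfFinrankEq ℤ _ hrank
  let b : Module.Basis (Fin d) ℝ E := (EuclideanSpace.basisFun (Fin d) ℝ).toBasis
  let e (i : Fin N) : (Fin N → ℤ) ⧸ H := H.mkQ (Pi.single i 1)
  have hcomb (g : ((Fin N → ℤ) ⧸ H) →ₗ[ℤ] E) (k : Fin N → ℤ) :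
      ∑ i, (k i : ℝ) • g (e i) = g (H.mkQ k) := by
    simp [e, mkQ_eq_sum_smul_mkQ_single H k, Int.cast_smul_eq_zsmul]
  let f : ((Fin N → ℤ) ⧸ H) →ₗ[ℤ] E := c.constr ℤ b
  have hfc (j : Fin d) : f (c j) = b j := c.constr_basis ℤ b j
  have hspan : Submodule.span ℝ (Set.range fun i => f (e i)) = ⊤ := by
    rw [eq_top_iff, ← b.span_eq, Submodule.span_le]
    rintro _ ⟨j, rfl⟩
    obtain ⟨s, hs⟩ := H.mkQ_surjective (c j)
    rw [SetLike.mem_coe, ← hfc, ← hs, ← hcomb]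
    exact Submodule.sum_mem _ fun i _ =>
      Submodule.smul_mem _ _ (Submodule.subset_span (Set.mem_range_self i))
  obtain ⟨A, hA, hAf⟩ := exists_injective_oneTight_comp hspan
  let A' : E ≃ₗ[ℝ] E := LinearEquiv.ofInjectiveEndo A hA
  have hA' (x : E) : A' x = A x := rfl
  let g : ((Fin N → ℤ) ⧸ H) →ₗ[ℤ] E := A.restrictScalars ℤ ∘ₗ f
  have hgc (j : Fin d) : g (c j) = (b.map A') j := by simp [g, hfc, hA']
  have hg_inj : Function.Injective g := by
    refine LinearMap.injective_of_linearIndependent c.span_eq ?_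
    rw [show g ∘ c = b.map A' from funext hgc]
    exact (b.map A').linearIndependent.restrict_scalars' ℤ
  refine ⟨fun i => g (e i), span_range_eq_top_of_oneTight hAf, hAf, ?_, fun k => ?_, ?_⟩
  · have hmem (x) : g x ∈ Submodule.span ℤ (Set.range (b.map A')) := by
      rw [← c.sum_repr x, map_sum]
      refine Submodule.sum_mem _ fun j _ => ?_
      rw [map_smul, hgc]
      exact Submodule.smul_mem _ _ (Submodule.subset_span (Set.mem_range_self j))
    have hdisc : DiscreteTopology (Submodule.span ℤ (Set.range (b.map A'))) := inferInstance
    refine DiscreteTopology.of_subset hdisc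
      ((AddSubgroup.closure_le (Submodule.span ℤ (Set.range (b.map A'))).toAddSubgroup).2 ?_)
    rintro _ ⟨i, rfl⟩
    exact hmem _
  · rw [hcomb, map_eq_zero_iff g hg_inj, Submodule.mkQ_apply, Submodule.Quotient.mk_eq_zero]
  · intro w _ hw _ hwH
    let h : ((Fin N → ℤ) ⧸ H) →ₗ[ℤ] E := H.liftQ (Fintype.linearCombination ℤ w) fun k hk => by
      simpa [Fintype.linearCombination_apply, Int.cast_smul_eq_zsmul] using (hwH k).2 hk
    have hhe (i : Fin N) : h (e i) = w i := by
      simp [h, e]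
    let B : E →ₗ[ℝ] E := (b.map A').constr ℝ (h ∘ c)
    have hBg : B.restrictScalars ℤ ∘ₗ g = h := c.ext fun j => by
      change B (g (c j)) = h (c j)
      rw [hgc]
      exact (b.map A').constr_basis ℝ _ j
    have hB (i : Fin N) : B (g (e i)) = w i := by
      rw [← hhe, ← hBg]; rfl
    obtain ⟨U, hU⟩ := exists_linearIsometryEquiv_of_oneTight (v := fun i => g (e i)) B hAf
      (by simpa only [hB] using hw)
    exact ⟨U, fun i => by rw [hU, hB]⟩
end

section
/- The Gram matrix of a crystallographic 1-tight frame is rational: if v_1, …, v_N is a 1-tight frame of ℝ^d such that the additive subgroup of ℝ^d generated by v_1, …, v_N is discrete, then ⟨v_i, v_j⟩ ∈ ℚ for all i, j = 1, …, N. -/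
open scoped RealInnerProductSpace

/-- A left inverse over `ℝ` of a rational square matrix is rational. -/
theorem exists_rat_of_mul_map_eq_one {ι : Type*} [Fintype ι] [DecidableEq ι]
    {G : Matrix ι ι ℝ} {M : Matrix ι ι ℚ} (h : G * M.map (algebraMap ℚ ℝ) = 1) :
    ∃ H : Matrix ι ι ℚ, G = H.map (algebraMap ℚ ℝ) := by
  have hdet : IsUnit M.det := by
    rw [isUnit_iff_ne_zero]
    intro h0
    have h1 := congrArg Matrix.det h
    have h2 : (M.map (algebraMap ℚ ℝ)).det = algebraMap ℚ ℝ M.det :=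
      (RingHom.map_det (algebraMap ℚ ℝ) M).symm
    rw [Matrix.det_mul, h2, h0] at h1
    simp at h1
  refine ⟨M⁻¹, ?_⟩
  calc G = G * (M * M⁻¹).map (algebraMap ℚ ℝ) := by
        rw [Matrix.mul_nonsing_inv M hdet, Matrix.map_one _ (map_zero _) (map_one _), mul_one]
    _ = M⁻¹.map (algebraMap ℚ ℝ) := by rw [Matrix.map_mul, ← mul_assoc, h, one_mul]

/-- If the vectors of a `1`-tight frame have rational coordinates in some basis, then the
Gram matrix of the frame is rational. -/
theorem gram_rational_of_rational_coordinates {E κ ι : Type*} [NormedAddCommGroup E]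
    [InnerProductSpace ℝ E] [Fintype κ] [Fintype ι] (b : Module.Basis ι ℝ E)
    (v : κ → E) (htight : ∀ x : E, ∑ i, ⟪x, v i⟫ • v i = x) (A : κ → ι → ℚ)
    (hA : ∀ i, v i = ∑ k, (A i k : ℝ) • b k) (i j : κ) :
    ∃ q : ℚ, ⟪v i, v j⟫ = q := by
  classical
  let M : Matrix ι ι ℚ := Matrix.of fun l m => ∑ i, A i l * A i m
  have hrepr (i : κ) (m : ι) : b.repr (v i) m = A i m := by
    rw [hA, b.repr_sum_self]
  have hGM : Matrix.of (fun k l => ⟪b k, b l⟫) * M.map (algebraMap ℚ ℝ) = 1 := by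
    ext k m
    have h := congrArg (fun x => b.repr x m) (htight (b k))
    simp only [map_sum, map_smul, Finsupp.coe_finsetSum, Finset.sum_apply, Finsupp.smul_apply,
      hrepr, smul_eq_mul, Module.Basis.repr_self, Finsupp.single_apply] at h
    rw [Matrix.one_apply, ← h, Matrix.mul_apply]
    simp only [Matrix.of_apply, Matrix.map_apply, M, map_sum, map_mul, eq_ratCast,
      Finset.mul_sum]
    rw [Finset.sum_comm]
    refine Finset.sum_congr rfl fun i _ => ?_
    rw [hA i, inner_sum, Finset.sum_mul]
    refine Finset.sum_congr rfl fun l _ => ?_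
    rw [real_inner_smul_right]
    ring
  obtain ⟨H, hH⟩ := exists_rat_of_mul_map_eq_one hGM
  have hb (k l : ι) : ⟪b k, b l⟫ = (H k l : ℝ) := congrFun (congrFun hH k) l
  refine ⟨∑ l, ∑ k, A j l * (A i k * H k l), ?_⟩
  rw [hA i, hA j]
  simp [sum_inner, inner_sum, real_inner_smul_left, real_inner_smul_right, hb]

/-- The Gram matrix of a crystallographic `1`-tight frame is rational: if the frame vectors
generate a discrete subgroup of `ℝ^d`, then all inner products `⟪v i, v j⟫` are rational. -/
theorem gram_rational_of_crystallographic_oneTight {N d : ℕ}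
    (v : Fin N → EuclideanSpace ℝ (Fin d))
    (hspan : Submodule.span ℝ (Set.range v) = ⊤)
    (htight : ∀ x : EuclideanSpace ℝ (Fin d), ∑ i, ⟪x, v i⟫ • v i = x)
    (hdisc : DiscreteTopology (AddSubgroup.closure (Set.range v))) :
    ∀ i j, ∃ q : ℚ, ⟪v i, v j⟫ = q := by
  let L : Submodule ℤ (EuclideanSpace ℝ (Fin d)) := Submodule.span ℤ (Set.range v)
  have : DiscreteTopology L := by
    rw [← Submodule.span_int_eq_addSubgroupClosure] at hdisc
    exact hdisc
  have : IsZLattice ℝ L := ⟨by rw [Submodule.span_span_of_tower, hspan]⟩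
  have hmem (i : Fin N) : v i ∈ L := Submodule.subset_span (Set.mem_range_self i)
  let b := Module.Free.chooseBasis ℤ L
  refine gram_rational_of_rational_coordinates (b.ofZLatticeBasis ℝ L) v htight
    (fun i k => (b.repr ⟨v i, hmem i⟩ k : ℚ)) fun i => ?_
  refine ((b.ofZLatticeBasis ℝ L).sum_repr (v i)).symm.trans ?_
  refine Finset.sum_congr rfl fun k _ => ?_
  rw [b.ofZLatticeBasis_repr_apply ℝ L ⟨v i, hmem i⟩ k, Rat.cast_intCast]
end

section
/- The period lattice of a crystallographic 1-tight frame is rational: if v_1, …, v_N is a crystallographic 1-tight frame of ℝ^d and L_S = { k_1 v_1 + ⋯ + k_N v_N : k_i ∈ ℤ } is its period lattice, then ⟨u, w⟩ ∈ ℚ for all u, w ∈ L_S. -/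
open scoped RealInnerProductSpace

/-- If a finite family of vectors with integer coordinates in a basis `b` is `1`-tight, then the
Gram matrix of `b` is rational. -/
theorem exists_rat_gram_of_oneTight_of_int_coords {E κ ι : Type*} [NormedAddCommGroup E]
    [InnerProductSpace ℝ E] [Fintype κ] [Fintype ι] (b : Module.Basis ι ℝ E)
    (v : κ → E) (A : Matrix κ ι ℤ) (hA : ∀ i, v i = ∑ j, (A i j : ℝ) • b j)
    (htight : ∀ x : E, ∑ i, ⟪x, v i⟫ • v i = x) :
    ∃ G : Matrix ι ι ℚ, ∀ j k, ⟪b j, b k⟫ = (G j k : ℝ) := by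
  classical
  let M : Matrix ι ι ℚ := (A.transpose * A).map (Int.castRingHom ℚ)
  let H : Matrix ι ι ℝ := Matrix.of fun j k => ⟪b j, b k⟫
  have hM (k m : ι) : ((M k m : ℚ) : ℝ) = ∑ i, (A i k : ℝ) * A i m := by
    simp [M, Matrix.mul_apply]
  have hHM : H * M.map (Rat.castHom ℝ) = 1 := by
    ext j m
    have hcoord := congrArg (fun x => b.repr x m) (htight (b j))
    have hcoef (i : κ) : b.repr (v i) m = A i m := by
      rw [hA i, b.repr_sum_self]
    have hinner (i : κ) : ⟪b j, v i⟫ = ∑ k, (A i k : ℝ) * ⟪b j, b k⟫ := by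
      simp [hA i, inner_sum, real_inner_smul_right]
    simp only [map_sum, map_smul, Finsupp.coe_finsetSum, Finset.sum_apply, Finsupp.smul_apply,
      hcoef, hinner, smul_eq_mul, b.repr_self, Finsupp.single_apply] at hcoord
    rw [Matrix.one_apply, ← hcoord, Matrix.mul_apply]
    simp only [Matrix.map_apply, Rat.coe_castHom, hM, H, Matrix.of_apply, Finset.mul_sum,
      Finset.sum_mul]
    rw [Finset.sum_comm]
    exact Finset.sum_congr rfl fun i _ => Finset.sum_congr rfl fun k _ => by ring
  have hdet : IsUnit M.det := by
    rw [isUnit_iff_ne_zero]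
    intro h
    have hdetR := congrArg Matrix.det hHM
    rw [Matrix.det_mul, ← RingHom.mapMatrix_apply, ← RingHom.map_det, h] at hdetR
    simp at hdetR
  have hinv : M.map (Rat.castHom ℝ) * M⁻¹.map (Rat.castHom ℝ) = 1 := by
    rw [← Matrix.map_mul, Matrix.mul_nonsing_inv M hdet]
    simp
  have hH : H = M⁻¹.map (Rat.castHom ℝ) := left_inv_eq_right_inv hHM hinv
  exact ⟨M⁻¹, fun j k => congrFun (congrFun hH j) k⟩

/-- The period lattice of a crystallographic `1`-tight frame is rational: for any two elements
`u, w` of the additive subgroup of `ℝ^d` generated by the frame vectors, `⟪u, w⟫` is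
rational. -/
theorem period_lattice_rational_of_crystallographic_oneTight {N d : ℕ}
    (v : Fin N → EuclideanSpace ℝ (Fin d))
    (hspan : Submodule.span ℝ (Set.range v) = ⊤)
    (htight : ∀ x : EuclideanSpace ℝ (Fin d), ∑ i, ⟪x, v i⟫ • v i = x)
    (hdisc : DiscreteTopology (AddSubgroup.closure (Set.range v))) :
    ∀ u ∈ AddSubgroup.closure (Set.range v), ∀ w ∈ AddSubgroup.closure (Set.range v),
      ∃ q : ℚ, ⟪u, w⟫ = q := by
  let L : Submodule ℤ (EuclideanSpace ℝ (Fin d)) :=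
    (AddSubgroup.closure (Set.range v)).toIntSubmodule
  have : DiscreteTopology L := hdisc
  have : IsZLattice ℝ L :=
    ⟨top_le_iff.mp (hspan.ge.trans (Submodule.span_mono AddSubgroup.subset_closure))⟩
  have : Module.Free ℤ L := ZLattice.module_free ℝ L
  have : Module.Finite ℤ L := ZLattice.module_finite ℝ L
  let c := Module.Free.chooseBasis ℤ L
  let b := c.ofZLatticeBasis ℝ L
  have hcoords (x : L) : (x : EuclideanSpace ℝ (Fin d)) = ∑ j, (c.repr x j : ℝ) • b j := by
    simpa [b, Module.Basis.ofZLatticeBasis_apply, Int.cast_smul_eq_zsmul, -Module.Basis.sum_repr]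
      using (congrArg L.subtype (c.sum_repr x)).symm
  have hmem (i : Fin N) : v i ∈ L := AddSubgroup.subset_closure (Set.mem_range_self i)
  obtain ⟨G, hG⟩ := exists_rat_gram_of_oneTight_of_int_coords b v
    (Matrix.of fun i j => c.repr ⟨v i, hmem i⟩ j) (fun i => hcoords ⟨v i, hmem i⟩) htight
  have hrat (x y : L) :
      ∃ q : ℚ, ⟪(x : EuclideanSpace ℝ (Fin d)), (y : EuclideanSpace ℝ (Fin d))⟫ = q := by
    refine ⟨∑ k, ∑ j, (c.repr y k : ℚ) * ((c.repr x j : ℚ) * G j k), ?_⟩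
    rw [hcoords x, hcoords y]
    simp only [sum_inner, inner_sum, real_inner_smul_left, real_inner_smul_right, hG]
    push_cast
    rfl
  exact fun u hu w hw => hrat ⟨u, hu⟩ ⟨w, hw⟩
end

section
/- Let L be a full-rank lattice in ℝ^d (a discrete subgroup spanning ℝ^d). The coincidence symmetry group G(L) = { g ∈ SO(d) : gL and L are commensurable } is dense in SO(d) if and only if L is essentially rational, i.e. there exists λ > 0 such that ⟨x, y⟩ ∈ λℚ for all x, y ∈ L. -/
open scoped RealInnerProductSpace

/-- The transpose of a real matrix is the adjoint of its action on Euclidean space. -/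
theorem Matrix.inner_toEuclideanLin_left {d : ℕ} (A : Matrix (Fin d) (Fin d) ℝ)
    (x y : EuclideanSpace ℝ (Fin d)) :
    ⟪Matrix.toEuclideanLin A x, y⟫ = ⟪x, Matrix.toEuclideanLin A.transpose y⟫ := by
  rw [← Matrix.conjTranspose_eq_transpose_of_trivial, Matrix.toEuclideanLin_conjTranspose_eq_adjoint,
    LinearMap.adjoint_inner_right]

theorem Matrix.toEuclideanLin_mul_apply {d : ℕ} (A B : Matrix (Fin d) (Fin d) ℝ)
    (x : EuclideanSpace ℝ (Fin d)) :
    Matrix.toEuclideanLin (A * B) x = Matrix.toEuclideanLin A (Matrix.toEuclideanLin B x) := by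
  simp [Matrix.toLpLin_apply, Matrix.mulVec_mulVec]

theorem Matrix.toEuclideanLin_one_apply {d : ℕ} (x : EuclideanSpace ℝ (Fin d)) :
    Matrix.toEuclideanLin (1 : Matrix (Fin d) (Fin d) ℝ) x = x := by
  simp

/-- The matrix of the reflection in the hyperplane orthogonal to `v` (the identity if `v = 0`). -/
noncomputable def reflectionMatrix {d : ℕ} (v : EuclideanSpace ℝ (Fin d)) :
    Matrix (Fin d) (Fin d) ℝ :=
  1 - (2 / ⟪v, v⟫) • Matrix.vecMulVec v.ofLp v.ofLp

theorem toEuclideanLin_reflectionMatrix {d : ℕ} (v x : EuclideanSpace ℝ (Fin d)) :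
    Matrix.toEuclideanLin (reflectionMatrix v) x = x - (2 * (⟪v, x⟫ / ⟪v, v⟫)) • v := by
  have h : v.ofLp ⬝ᵥ x.ofLp = ⟪v, x⟫ := by
    rw [EuclideanSpace.inner_eq_star_dotProduct, dotProduct_comm]; simp
  ext i
  simp only [Matrix.toLpLin_apply, reflectionMatrix, Matrix.sub_mulVec, Matrix.one_mulVec,
    Matrix.smul_mulVec, Matrix.vecMulVec_mulVec, h]
  simp
  ring

theorem toEuclideanLin_reflectionMatrix_eq_reflection {d : ℕ}
    (v x : EuclideanSpace ℝ (Fin d)) :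
    Matrix.toEuclideanLin (reflectionMatrix v) x = (ℝ ∙ v)ᗮ.reflection x := by
  rw [toEuclideanLin_reflectionMatrix, Submodule.reflection_orthogonal_apply,
    Submodule.reflection_singleton_apply, real_inner_self_eq_norm_sq, mul_smul]
  simp [two_smul]

theorem transpose_reflectionMatrix {d : ℕ} (v : EuclideanSpace ℝ (Fin d)) :
    (reflectionMatrix v).transpose = reflectionMatrix v := by
  simp [reflectionMatrix, Matrix.transpose_vecMulVec]

theorem reflectionMatrix_mul_self {d : ℕ} (v : EuclideanSpace ℝ (Fin d)) :
    reflectionMatrix v * reflectionMatrix v = 1 := by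
  apply Matrix.toEuclideanLin.injective
  ext1 x
  rw [Matrix.toEuclideanLin_mul_apply, Matrix.toEuclideanLin_one_apply,
    toEuclideanLin_reflectionMatrix_eq_reflection, toEuclideanLin_reflectionMatrix_eq_reflection,
    Submodule.reflection_reflection]

theorem det_reflectionMatrix {d : ℕ} {v : EuclideanSpace ℝ (Fin d)} (hv : v ≠ 0) :
    (reflectionMatrix v).det = -1 := by
  have h : v.ofLp ⬝ᵥ v.ofLp = ⟪v, v⟫ := by
    rw [EuclideanSpace.inner_eq_star_dotProduct]; simp
  have hv' : ⟪v, v⟫ ≠ 0 := inner_self_ne_zero.mpr hv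
  have : reflectionMatrix v = 1 + Matrix.replicateCol Unit (-(2 / ⟪v, v⟫) • v.ofLp) *
      Matrix.replicateRow Unit v.ofLp := by
    rw [← Matrix.vecMulVec_eq, reflectionMatrix, Matrix.smul_vecMulVec, neg_smul, sub_eq_add_neg]
  rw [this, Matrix.det_one_add_replicateCol_mul_replicateRow, dotProduct_smul, h, smul_eq_mul]
  field_simp
  norm_num

theorem continuousAt_reflectionMatrix {d : ℕ} {v : EuclideanSpace ℝ (Fin d)} (hv : v ≠ 0) :
    ContinuousAt reflectionMatrix v := by
  have hv' : ⟪v, v⟫ ≠ 0 := inner_self_ne_zero.mpr hv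
  have h : Continuous fun v : EuclideanSpace ℝ (Fin d) => Matrix.vecMulVec v.ofLp v.ofLp :=
    Continuous.matrix_vecMulVec (by fun_prop) (by fun_prop)
  unfold reflectionMatrix
  have hc : ContinuousAt (fun v : EuclideanSpace ℝ (Fin d) => 2 / ⟪v, v⟫) v :=
    continuousAt_const.div (by fun_prop) hv'
  exact continuousAt_const.sub (hc.smul h.continuousAt)

/-- The vectors having a nonzero integer multiple in `L`, i.e. the rational span of `L`. -/
def AddSubgroup.rationalSpan {V : Type*} [AddCommGroup V] (L : AddSubgroup V) :
    AddSubgroup V where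
  carrier := {v | ∃ n : ℤ, n ≠ 0 ∧ n • v ∈ L}
  zero_mem' := ⟨1, one_ne_zero, by simp [L.zero_mem]⟩
  add_mem' := by
    rintro a b ⟨n, hn, ha⟩ ⟨m, hm, hb⟩
    refine ⟨n * m, mul_ne_zero hn hm, ?_⟩
    have h1 := L.zsmul_mem ha m
    have h2 := L.zsmul_mem hb n
    rw [smul_add, mul_smul n m b, mul_comm, mul_smul m n a]
    exact L.add_mem h1 h2
  neg_mem' := by
    rintro a ⟨n, hn, ha⟩
    exact ⟨n, hn, by rw [smul_neg]; exact L.neg_mem ha⟩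

theorem AddSubgroup.mem_rationalSpan {V : Type*} [AddCommGroup V] {L : AddSubgroup V} {v : V} :
    v ∈ L.rationalSpan ↔ ∃ n : ℤ, n ≠ 0 ∧ n • v ∈ L := Iff.rfl

theorem AddSubgroup.le_rationalSpan {V : Type*} [AddCommGroup V] (L : AddSubgroup V) :
    L ≤ L.rationalSpan := fun v hv => ⟨1, one_ne_zero, by simpa using hv⟩

theorem AddSubgroup.ratCast_smul_mem_rationalSpan {V : Type*} [AddCommGroup V] [Module ℝ V]
    {L : AddSubgroup V} (q : ℚ) {v : V} (hv : v ∈ L.rationalSpan) :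
    (q : ℝ) • v ∈ L.rationalSpan := by
  obtain ⟨n, hn, hv⟩ := hv
  refine ⟨q.den * n, mul_ne_zero (by exact_mod_cast q.den_ne_zero) hn, ?_⟩
  have h : ((q.den * n : ℤ)) • (q : ℝ) • v = q.num • n • v := by
    rw [← Int.cast_smul_eq_zsmul ℝ, ← Int.cast_smul_eq_zsmul ℝ q.num,
      ← Int.cast_smul_eq_zsmul ℝ n, smul_smul, smul_smul]
    congr 1
    have : (q : ℝ) * q.den = q.num := by exact_mod_cast Rat.mul_den_eq_num q
    push_cast
    rw [← this]
    ring
  rw [h]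
  exact L.zsmul_mem hv _

/-- The rational span of a subgroup spanning a real vector space is dense. -/
theorem AddSubgroup.dense_rationalSpan {V : Type*} [AddCommGroup V] [Module ℝ V]
    [TopologicalSpace V] [IsTopologicalAddGroup V] [ContinuousSMul ℝ V] {L : AddSubgroup V}
    (hspan : Submodule.span ℝ (L : Set V) = ⊤) : Dense (L.rationalSpan : Set V) := by
  intro v
  change v ∈ L.rationalSpan.topologicalClosure
  have hv : v ∈ Submodule.span ℝ (L : Set V) := hspan ▸ Submodule.mem_top
  induction hv using Submodule.span_induction with
  | mem x hx => exact L.rationalSpan.le_topologicalClosure (L.le_rationalSpan hx)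
  | zero => exact zero_mem _
  | add x y _ _ hx hy => exact add_mem hx hy
  | smul t x _ hx =>
    exact map_mem_closure₂ continuous_smul (Rat.denseRange_cast t) hx
      (by rintro _ ⟨q, rfl⟩ y hy; exact AddSubgroup.ratCast_smul_mem_rationalSpan q hy)

/-- The orthogonal matrices whose inverse maps `L` into its rational span. -/
def coincidenceSubmonoid {d : ℕ} (L : AddSubgroup (EuclideanSpace ℝ (Fin d))) :
    Submonoid (Matrix (Fin d) (Fin d) ℝ) where
  carrier := {B | B.transpose * B = 1 ∧
    ∀ x ∈ L, Matrix.toEuclideanLin B.transpose x ∈ L.rationalSpan}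
  one_mem' := by
    refine ⟨by simp, fun x hx => ?_⟩
    rw [Matrix.transpose_one, Matrix.toEuclideanLin_one_apply]
    exact L.le_rationalSpan hx
  mul_mem' := by
    rintro A B ⟨hA, hAL⟩ ⟨hB, hBL⟩
    refine ⟨?_, fun x hx => ?_⟩
    · rw [Matrix.transpose_mul, Matrix.mul_assoc, ← Matrix.mul_assoc A.transpose, hA,
        Matrix.one_mul, hB]
    · obtain ⟨n, hn, h⟩ := hAL x hx
      obtain ⟨m, hm, h'⟩ := hBL _ h
      refine ⟨m * n, mul_ne_zero hm hn, ?_⟩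
      rwa [Matrix.transpose_mul, Matrix.toEuclideanLin_mul_apply, mul_smul, ← map_zsmul]

theorem reflectionMatrix_mem_coincidenceSubmonoid {d : ℕ}
    {L : AddSubgroup (EuclideanSpace ℝ (Fin d))} {lam : ℝ} (hlam : 0 < lam)
    (hL : ∀ x ∈ L, ∀ y ∈ L, ∃ q : ℚ, ⟪x, y⟫ = lam * q)
    {v : EuclideanSpace ℝ (Fin d)} (hv : v ∈ L.rationalSpan) :
    reflectionMatrix v ∈ coincidenceSubmonoid L := by
  refine ⟨by rw [transpose_reflectionMatrix, reflectionMatrix_mul_self], fun x hx => ?_⟩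
  rw [transpose_reflectionMatrix, toEuclideanLin_reflectionMatrix]
  refine L.rationalSpan.sub_mem (L.le_rationalSpan hx) ?_
  obtain ⟨n, hn, hnv⟩ := hv
  obtain ⟨p, hp⟩ := hL _ hnv x hx
  obtain ⟨q, hq⟩ := hL _ hnv _ hnv
  rw [← Int.cast_smul_eq_zsmul ℝ, real_inner_smul_left] at hp
  rw [← Int.cast_smul_eq_zsmul ℝ, real_inner_smul_left, real_inner_smul_right] at hq
  have hn' : (n : ℝ) ≠ 0 := by exact_mod_cast hn
  have : 2 * (⟪v, x⟫ / ⟪v, v⟫) = ((2 * n * (p / q) : ℚ) : ℝ) := by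
    rw [eq_div_of_mul_eq hn' ((mul_comm _ _).trans hp), show ⟪v, v⟫ = lam * q / n / n by
      rw [← hq]; field_simp]
    push_cast
    field_simp
  rw [this]
  exact AddSubgroup.ratCast_smul_mem_rationalSpan _ ⟨n, hn, hnv⟩

theorem reflectionMatrix_mem_closure_coincidenceSubmonoid {d : ℕ}
    {L : AddSubgroup (EuclideanSpace ℝ (Fin d))}
    (hspan : Submodule.span ℝ (L : Set (EuclideanSpace ℝ (Fin d))) = ⊤)
    {lam : ℝ} (hlam : 0 < lam)
    (hL : ∀ x ∈ L, ∀ y ∈ L, ∃ q : ℚ, ⟪x, y⟫ = lam * q) (v : EuclideanSpace ℝ (Fin d)) :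
    reflectionMatrix v ∈ (coincidenceSubmonoid L).topologicalClosure := by
  rcases eq_or_ne v 0 with rfl | hv
  · have : reflectionMatrix (0 : EuclideanSpace ℝ (Fin d)) = 1 := by simp [reflectionMatrix]
    rw [this]
    exact one_mem _
  · exact (mem_closure_image (continuousAt_reflectionMatrix hv)
      (AddSubgroup.dense_rationalSpan hspan v)) |> closure_mono (by
        rintro _ ⟨w, hw, rfl⟩
        exact reflectionMatrix_mem_coincidenceSubmonoid hlam hL hw)

/-- For an essentially rational lattice, every orthogonal matrix is a limit of coincidence
isometries. -/
theorem mem_closure_coincidenceSubmonoid {d : ℕ}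
    {L : AddSubgroup (EuclideanSpace ℝ (Fin d))}
    (hspan : Submodule.span ℝ (L : Set (EuclideanSpace ℝ (Fin d))) = ⊤)
    {lam : ℝ} (hlam : 0 < lam)
    (hL : ∀ x ∈ L, ∀ y ∈ L, ∃ q : ℚ, ⟪x, y⟫ = lam * q)
    {A : Matrix (Fin d) (Fin d) ℝ} (hA : A.transpose * A = 1) :
    A ∈ (coincidenceSubmonoid L).topologicalClosure := by
  have key : ∀ l : List (EuclideanSpace ℝ (Fin d)), ∀ x,
      Matrix.toEuclideanLin (l.map reflectionMatrix).prod x =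
        (l.map fun v => (ℝ ∙ v)ᗮ.reflection).prod x := by
    intro l
    induction l with
    | nil => intro x; exact Matrix.toEuclideanLin_one_apply x
    | cons v l ih =>
      intro x
      rw [List.map_cons, List.prod_cons, Matrix.toEuclideanLin_mul_apply, ih, List.map_cons,
        List.prod_cons, toEuclideanLin_reflectionMatrix_eq_reflection]
      rfl
  obtain ⟨l, -, hl⟩ := LinearIsometryEquiv.reflections_generate_dim
    (((Matrix.toEuclideanLin A).isometryOfInner fun x y => by
      rw [Matrix.inner_toEuclideanLin_left, ← Matrix.toEuclideanLin_mul_apply, hA,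
        Matrix.toEuclideanLin_one_apply]).toLinearIsometryEquiv rfl)
  have hAl : A = (l.map reflectionMatrix).prod := by
    apply Matrix.toEuclideanLin.injective
    ext1 x
    rw [key, ← hl]
    rfl
  rw [hAl]
  refine Submonoid.list_prod_mem _ fun B hB => ?_
  obtain ⟨v, -, rfl⟩ := List.mem_map.mp hB
  exact reflectionMatrix_mem_closure_coincidenceSubmonoid hspan hlam hL v

theorem span_map_inf_eq_top_of_mem_coincidenceSubmonoid {d : ℕ}
    {L : AddSubgroup (EuclideanSpace ℝ (Fin d))}
    (hspan : Submodule.span ℝ (L : Set (EuclideanSpace ℝ (Fin d))) = ⊤)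
    {B : Matrix (Fin d) (Fin d) ℝ} (hB : B ∈ coincidenceSubmonoid L) :
    Submodule.span ℝ
      ((AddSubgroup.map (Matrix.toEuclideanLin B).toAddMonoidHom L ⊓ L :
        AddSubgroup (EuclideanSpace ℝ (Fin d))) : Set (EuclideanSpace ℝ (Fin d))) = ⊤ := by
  rw [eq_top_iff, ← hspan, Submodule.span_le]
  intro x hx
  obtain ⟨n, hn, h⟩ := hB.2 x hx
  have hn' : (n : ℝ) ≠ 0 := by exact_mod_cast hn
  have hmem : n • x ∈ (AddSubgroup.map (Matrix.toEuclideanLin B).toAddMonoidHom L ⊓ L :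
      AddSubgroup (EuclideanSpace ℝ (Fin d))) := by
    refine ⟨⟨_, h, ?_⟩, L.zsmul_mem hx n⟩
    change Matrix.toEuclideanLin B _ = _
    rw [map_zsmul, ← Matrix.toEuclideanLin_mul_apply, mul_eq_one_comm.mp hB.1,
      Matrix.toEuclideanLin_one_apply]
  have := Submodule.smul_mem _ ((n : ℝ)⁻¹) (Submodule.subset_span (R := ℝ) hmem)
  rwa [← Int.cast_smul_eq_zsmul ℝ, inv_smul_smul₀ hn'] at this

/-- Composing the inner product on a lattice with a `ℚ`-linear functional extends to a real
bilinear form on the whole space. -/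
theorem exists_bilinForm_eq_dual_inner {d : ℕ} (L : AddSubgroup (EuclideanSpace ℝ (Fin d)))
    (hdisc : DiscreteTopology L)
    (hspan : Submodule.span ℝ (L : Set (EuclideanSpace ℝ (Fin d))) = ⊤)
    (f : ℝ →ₗ[ℚ] ℚ) :
    ∃ F : LinearMap.BilinForm ℝ (EuclideanSpace ℝ (Fin d)),
      ∀ x ∈ L, ∀ y ∈ L, F x y = f ⟪x, y⟫ := by
  let Λ : Submodule ℤ (EuclideanSpace ℝ (Fin d)) := AddSubgroup.toIntSubmodule L
  have : DiscreteTopology Λ := hdisc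
  have : IsZLattice ℝ Λ := ⟨hspan⟩
  have := ZLattice.module_free ℝ Λ
  let b := (Module.Free.chooseBasis ℤ Λ).ofZLatticeBasis ℝ Λ
  have hb : Submodule.span ℤ (Set.range b) = Λ :=
    (Module.Free.chooseBasis ℤ Λ).ofZLatticeBasis_span ℝ
  have hF : ∀ i j, b.constr ℝ (fun i => b.constr ℝ fun j => (f ⟪b i, b j⟫ : ℝ)) (b i) (b j) =
      (f ⟪b i, b j⟫ : ℝ) := fun i j => by simp
  generalize b.constr ℝ (fun i => b.constr ℝ fun j => (f ⟪b i, b j⟫ : ℝ)) = F at hF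
  refine ⟨F, fun x hx y hy => ?_⟩
  replace hx : x ∈ Submodule.span ℤ (Set.range b) := by rw [hb]; exact hx
  replace hy : y ∈ Submodule.span ℤ (Set.range b) := by rw [hb]; exact hy
  induction hx, hy using Submodule.span_induction₂ with
  | mem_mem x y hx hy =>
    obtain ⟨i, rfl⟩ := hx
    obtain ⟨j, rfl⟩ := hy
    exact hF i j
  | zero_left y hy => simp
  | zero_right x hx => simp
  | add_left x y z _ _ _ h₁ h₂ => simp [inner_add_left, h₁, h₂]
  | add_right x y z _ _ _ h₁ h₂ => simp [inner_add_right, h₁, h₂]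
  | smul_left r x y _ _ h =>
    rw [← Int.cast_smul_eq_zsmul ℝ, real_inner_smul_left, ← zsmul_eq_mul, map_zsmul, map_smul,
      LinearMap.smul_apply, h]
    simp
  | smul_right r x y _ _ h =>
    rw [← Int.cast_smul_eq_zsmul ℝ, real_inner_smul_right, ← zsmul_eq_mul, map_zsmul, map_smul, h]
    simp

/-- A bilinear form which on a lattice is a function of the inner product is invariant under the
transposes of the coincidence isometries of that lattice. -/
theorem bilinForm_transpose_invariant {d : ℕ} {L : AddSubgroup (EuclideanSpace ℝ (Fin d))}
    {F : LinearMap.BilinForm ℝ (EuclideanSpace ℝ (Fin d))} {f : ℝ → ℝ}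
    (hF : ∀ x ∈ L, ∀ y ∈ L, F x y = f ⟪x, y⟫) {B : Matrix (Fin d) (Fin d) ℝ}
    (hB : B.transpose * B = 1)
    (hspan : Submodule.span ℝ
      ((AddSubgroup.map (Matrix.toEuclideanLin B).toAddMonoidHom L ⊓ L :
        AddSubgroup (EuclideanSpace ℝ (Fin d))) : Set (EuclideanSpace ℝ (Fin d))) = ⊤)
    (z w : EuclideanSpace ℝ (Fin d)) :
    F (Matrix.toEuclideanLin B.transpose z) (Matrix.toEuclideanLin B.transpose w) = F z w := by
  have h : F.compl₁₂ (Matrix.toEuclideanLin B.transpose) (Matrix.toEuclideanLin B.transpose) =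
      F := by
    refine LinearMap.ext_on hspan fun z hz => LinearMap.ext_on hspan fun w hw => ?_
    obtain ⟨⟨x, hx, rfl⟩, hz⟩ := hz
    obtain ⟨⟨y, hy, rfl⟩, hw⟩ := hw
    rw [hF _ hz _ hw]
    change F (Matrix.toEuclideanLin B.transpose (Matrix.toEuclideanLin B x))
      (Matrix.toEuclideanLin B.transpose (Matrix.toEuclideanLin B y)) =
      f ⟪Matrix.toEuclideanLin B x, Matrix.toEuclideanLin B y⟫
    rw [Matrix.inner_toEuclideanLin_left, ← Matrix.toEuclideanLin_mul_apply,
      ← Matrix.toEuclideanLin_mul_apply, hB, Matrix.toEuclideanLin_one_apply,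
      Matrix.toEuclideanLin_one_apply, hF x hx y hy]
  exact LinearMap.congr_fun₂ h z w

theorem continuous_bilinForm_transpose {d : ℕ}
    (F : LinearMap.BilinForm ℝ (EuclideanSpace ℝ (Fin d))) (z w : EuclideanSpace ℝ (Fin d)) :
    Continuous fun B : Matrix (Fin d) (Fin d) ℝ =>
      F (Matrix.toEuclideanLin B.transpose z) (Matrix.toEuclideanLin B.transpose w) := by
  have h : ∀ z : EuclideanSpace ℝ (Fin d), Continuous fun B : Matrix (Fin d) (Fin d) ℝ =>
      Matrix.toEuclideanLin B.transpose z := fun z => by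
    simp only [Matrix.toLpLin_apply]
    exact (PiLp.continuous_toLp 2 _).comp
      (Continuous.matrix_mulVec continuous_id.matrix_transpose continuous_const)
  have hF : Continuous fun p : EuclideanSpace ℝ (Fin d) × EuclideanSpace ℝ (Fin d) =>
      F p.1 p.2 := by
    have : Continuous fun p : EuclideanSpace ℝ (Fin d) × EuclideanSpace ℝ (Fin d) =>
        LinearMap.toContinuousLinearMap
          (LinearMap.toContinuousLinearMap.toLinearMap ∘ₗ F) p.1 p.2 := by fun_prop
    exact this
  exact hF.comp ((h z).prodMk (h w))

/-- A symmetric bilinear form invariant under all rotations is a multiple of the inner product. -/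
theorem exists_eq_mul_inner_of_rotation_invariant {d : ℕ}
    (F : LinearMap.BilinForm ℝ (EuclideanSpace ℝ (Fin d))) (hsymm : ∀ x y, F x y = F y x)
    (hinv : ∀ A : Matrix (Fin d) (Fin d) ℝ, A.transpose * A = 1 → A.det = 1 → ∀ z w,
      F (Matrix.toEuclideanLin A.transpose z) (Matrix.toEuclideanLin A.transpose w) = F z w) :
    ∃ c : ℝ, ∀ x y, F x y = c * ⟪x, y⟫ := by
  let e := EuclideanSpace.basisFun (Fin d) ℝ
  have rot : ∀ i j, i ≠ j → F (e i) (e j) = 0 ∧ F (e i) (e i) = F (e j) (e j) := by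
    intro i j hij
    have hii : ∀ k, ⟪e k, e k⟫ = 1 := fun k => by simp [e]
    have hij' : ⟪e i, e j⟫ = 0 := e.orthonormal.2 hij
    have hji' : ⟪e j, e i⟫ = 0 := e.orthonormal.2 hij.symm
    have hi0 : e i ≠ 0 := e.orthonormal.ne_zero i
    have hne : e i - e j ≠ 0 := sub_ne_zero.mpr fun h =>
      hij (e.orthonormal.linearIndependent.injective h)
    have hA := hinv (reflectionMatrix (e i) * reflectionMatrix (e i - e j))
      (by rw [Matrix.transpose_mul, transpose_reflectionMatrix, transpose_reflectionMatrix,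
            Matrix.mul_assoc, ← Matrix.mul_assoc (reflectionMatrix (e i)),
            reflectionMatrix_mul_self, Matrix.one_mul, reflectionMatrix_mul_self])
      (by rw [Matrix.det_mul, det_reflectionMatrix hi0, det_reflectionMatrix hne]; norm_num)
    rw [Matrix.transpose_mul, transpose_reflectionMatrix, transpose_reflectionMatrix] at hA
    have h1 : Matrix.toEuclideanLin (reflectionMatrix (e i - e j) * reflectionMatrix (e i)) (e i)
        = -e j := by
      rw [Matrix.toEuclideanLin_mul_apply]
      simp only [toEuclideanLin_reflectionMatrix, inner_sub_left, inner_sub_right,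
        real_inner_smul_right, hii, hij', hji']
      module
    have h2 : Matrix.toEuclideanLin (reflectionMatrix (e i - e j) * reflectionMatrix (e i)) (e j)
        = e i := by
      rw [Matrix.toEuclideanLin_mul_apply]
      simp only [toEuclideanLin_reflectionMatrix, inner_sub_left, inner_sub_right,
        real_inner_smul_right, hii, hij', hji']
      module
    have h3 := hA (e i) (e j)
    have h4 := hA (e i) (e i)
    rw [h1, h2] at h3
    rw [h1] at h4
    simp only [map_neg, LinearMap.neg_apply, neg_neg] at h3 h4
    rw [hsymm (e j)] at h3
    exact ⟨by linarith, h4.symm⟩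
  rcases isEmpty_or_nonempty (Fin d) with hd | ⟨⟨k⟩⟩
  · exact ⟨0, fun x y => by simp [Subsingleton.elim x 0]⟩
  · refine ⟨F (e k) (e k), fun x y => ?_⟩
    have : F = F (e k) (e k) • innerₗ (EuclideanSpace ℝ (Fin d)) := by
      refine e.toBasis.ext fun i => e.toBasis.ext fun j => ?_
      simp only [OrthonormalBasis.coe_toBasis, LinearMap.smul_apply, innerₗ_apply_apply,
        smul_eq_mul]
      by_cases hij : i = j
      · subst hij
        rw [show ⟪e i, e i⟫ = 1 by simp [e], mul_one]
        by_cases hik : i = k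
        · rw [hik]
        · exact (rot i k hik).2
      · rw [(rot i j hij).1, e.orthonormal.2 hij, mul_zero]
    exact LinearMap.congr_fun₂ this x y

/-- The coincidence symmetry group of a full-rank lattice `L` in `ℝ^d`, i.e. the set of
rotations `g ∈ SO(d)` such that `gL` and `L` are commensurable (their intersection is again a
full-rank lattice), is dense in `SO(d)` if and only if `L` is essentially rational: there is a
`λ > 0` with `⟪x, y⟫ ∈ λ·ℚ` for all `x, y ∈ L`.  Rotations are represented by matrices
`A` with `Aᵀ A = 1` and `det A = 1`, acting on `ℝ^d` via `Matrix.toEuclideanLin`. -/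
theorem coincidence_group_dense_iff_essentially_rational {d : ℕ}
    (L : AddSubgroup (EuclideanSpace ℝ (Fin d)))
    (hdisc : DiscreteTopology L)
    (hspan : Submodule.span ℝ (L : Set (EuclideanSpace ℝ (Fin d))) = ⊤) :
    (∀ A : Matrix (Fin d) (Fin d) ℝ, A.transpose * A = 1 → A.det = 1 →
      A ∈ closure {B : Matrix (Fin d) (Fin d) ℝ | B.transpose * B = 1 ∧ B.det = 1 ∧
        DiscreteTopology
          ((AddSubgroup.map (Matrix.toEuclideanLin B).toAddMonoidHom L ⊓ L :
            AddSubgroup (EuclideanSpace ℝ (Fin d)))) ∧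
        Submodule.span ℝ
          ((AddSubgroup.map (Matrix.toEuclideanLin B).toAddMonoidHom L ⊓ L :
            AddSubgroup (EuclideanSpace ℝ (Fin d))) : Set (EuclideanSpace ℝ (Fin d))) = ⊤}) ↔
    ∃ lam : ℝ, 0 < lam ∧ ∀ x ∈ L, ∀ y ∈ L, ∃ q : ℚ, ⟪x, y⟫ = lam * q := by
  constructor
  · intro hdense
    by_cases h0 : ∀ x ∈ L, ∀ y ∈ L, ⟪x, y⟫ = 0
    · exact ⟨1, one_pos, fun x hx y hy => ⟨0, by simp [h0 x hx y hy]⟩⟩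
    push Not at h0
    obtain ⟨x₀, hx₀, y₀, hy₀, h0⟩ := h0
    obtain ⟨f, hf⟩ := Module.Projective.exists_dual_ne_zero ℚ h0
    obtain ⟨F, hF⟩ := exists_bilinForm_eq_dual_inner L hdisc hspan f
    have hflip : F = LinearMap.flip F :=
      LinearMap.ext_on hspan fun x hx => LinearMap.ext_on hspan fun y hy => by
        rw [LinearMap.flip_apply, hF x hx y hy, hF y hy x hx, real_inner_comm]
    have hsymm : ∀ x y, F x y = F y x := LinearMap.congr_fun₂ hflip
    have hinv : ∀ A : Matrix (Fin d) (Fin d) ℝ, A.transpose * A = 1 → A.det = 1 → ∀ z w,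
        F (Matrix.toEuclideanLin A.transpose z) (Matrix.toEuclideanLin A.transpose w) =
          F z w := by
      intro A hA hdet z w
      have hclosed : IsClosed {B : Matrix (Fin d) (Fin d) ℝ |
          F (Matrix.toEuclideanLin B.transpose z) (Matrix.toEuclideanLin B.transpose w) =
            F z w} :=
        isClosed_eq (continuous_bilinForm_transpose F z w) continuous_const
      refine closure_minimal ?_ hclosed (hdense A hA hdet)
      rintro B ⟨hB, -, -, hBspan⟩
      exact bilinForm_transpose_invariant (f := fun t => (f t : ℝ)) hF hB hBspan z w
    obtain ⟨c, hc⟩ := exists_eq_mul_inner_of_rotation_invariant F hsymm hinv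
    have hc0 : c ≠ 0 := by
      rintro rfl
      have := hF x₀ hx₀ y₀ hy₀
      rw [hc, zero_mul] at this
      exact hf (by exact_mod_cast this.symm)
    have hinner : ∀ x ∈ L, ∀ y ∈ L, ⟪x, y⟫ = c⁻¹ * f ⟪x, y⟫ := fun x hx y hy => by
      rw [← hF x hx y hy, hc, inv_mul_cancel_left₀ hc0]
    rcases lt_or_gt_of_ne hc0 with hneg | hpos
    · refine ⟨-c⁻¹, neg_pos.mpr (inv_lt_zero.mpr hneg), fun x hx y hy => ⟨-f ⟪x, y⟫, ?_⟩⟩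
      rw [Rat.cast_neg, neg_mul_neg]
      exact hinner x hx y hy
    · exact ⟨c⁻¹, inv_pos.mpr hpos, fun x hx y hy => ⟨f ⟪x, y⟫, hinner x hx y hy⟩⟩
  · rintro ⟨lam, hlam, hL⟩ A hA hdet
    have hopen : IsOpen {B : Matrix (Fin d) (Fin d) ℝ | 0 < B.det} :=
      isOpen_lt continuous_const continuous_id.matrix_det
    refine closure_mono ?_ (hopen.inter_closure
      ⟨by simp [hdet], mem_closure_coincidenceSubmonoid hspan hlam hL hA⟩)
    rintro B ⟨hpos, hB⟩
    have hdetB : B.det = 1 := by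
      have h := congrArg Matrix.det hB.1
      rw [Matrix.det_mul, Matrix.det_transpose, Matrix.det_one] at h
      have hpos : 0 < B.det := hpos
      nlinarith
    exact ⟨hB.1, hdetB, DiscreteTopology.of_subset hdisc fun _ h => h.2,
      span_map_inf_eq_top_of_mem_coincidenceSubmonoid hspan hB⟩
end
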